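/- For every integer d ≥ 3 there exists a unique (d−2)-tuple (T_0, T_1, …, T_{d−3}) of formal power series in ℚ[[x]], each with zero constant coefficient, such that for every 0 ≤ i ≤ d−3 one has T_i = (1−T_0)^{−1} · h_{i+2}(τ_1, …, τ_{i+2}), where τ_k = T_k·(1−T_0)^{−1} for 1 ≤ k ≤ d−3, τ_{d−2} = x·(1−T_0)^{−1}, and τ_k = 0 for k ≥ d−1. (Here 1−T_0 is invertible in ℚ[[x]] since its constant coefficient is 1.) -/

import Mathlib

open PowerSeries

/-- `h_j(τ) = Σ_{r ≥ 1} Σ_{i_1+⋯+i_r = j, i_l ≥ 1} τ_{i_1} ⋯ τ_{i_r}`, the generating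
polynomial of compositions of `j`, evaluated at `τ`. -/
noncomputable def hcomp (j : ℕ) (τ : ℕ → PowerSeries ℚ) : PowerSeries ℚ :=
  ∑ c : Composition j, (c.blocks.map τ).prod

/-- `S` and `T` agree to order `(l + i) / n` in the `i`-th coordinate, for every `i`. -/
def AgreeTo {n : ℕ} (l : ℕ) (S T : Fin n → PowerSeries ℚ) : Prop :=
  ∀ i : Fin n, (X : PowerSeries ℚ) ^ ((l + i) / n) ∣ S i - T i

namespace AgreeTo

variable {n : ℕ} {l : ℕ} {S T U : Fin n → PowerSeries ℚ}

theorem zero (S T : Fin n → PowerSeries ℚ) : AgreeTo 0 S T := fun i => by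
  simp [Nat.div_eq_of_lt i.isLt]

theorem symm (h : AgreeTo l S T) : AgreeTo l T S := fun i => by
  rw [dvd_sub_comm]; exact h i

theorem trans (h : AgreeTo l S T) (h' : AgreeTo l T U) : AgreeTo l S U := fun i => by
  simpa using dvd_add (h i) (h' i)

theorem mono {l' : ℕ} (hl : l' ≤ l) (h : AgreeTo l S T) : AgreeTo l' S T := fun i =>
  (pow_dvd_pow _ (Nat.div_le_div_right (by omega))).trans (h i)

theorem coeff_eq (h : AgreeTo l S T) (i : Fin n) {m : ℕ} (hm : m < (l + i) / n) :
    coeff m (S i) = coeff m (T i) := by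
  have := X_pow_dvd_iff.1 (h i) m hm
  rwa [map_sub, sub_eq_zero] at this

theorem eq_of_forall (h : ∀ l, AgreeTo l S T) : S = T := by
  funext i
  ext m
  have hn : 0 < n := i.pos
  refine (h (n * (m + 1))).coeff_eq i ?_
  rw [Nat.mul_add_div hn]
  exact Nat.lt_add_right _ (Nat.lt_succ_self m)

end AgreeTo

/-- A map on tuples of power series without constant term that improves agreement by one level
has a unique fixed point. -/
theorem existsUnique_fixed_of_agreeTo {n : ℕ}
    (Φ : (Fin n → PowerSeries ℚ) → Fin n → PowerSeries ℚ)
    (hc : ∀ T, (∀ i, constantCoeff (T i) = 0) → ∀ i, constantCoeff (Φ T i) = 0)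
    (hΦ : ∀ l S T, (∀ i, constantCoeff (S i) = 0) → (∀ i, constantCoeff (T i) = 0) →
      AgreeTo l S T → AgreeTo (l + 1) (Φ S) (Φ T)) :
    ∃! T : Fin n → PowerSeries ℚ, (∀ i, constantCoeff (T i) = 0) ∧ ∀ i, T i = Φ T i := by
  let t : ℕ → Fin n → PowerSeries ℚ := fun k => Φ^[k] 0
  have ht : ∀ k, t (k + 1) = Φ (t k) := fun k => Function.iterate_succ_apply' Φ k 0
  have hct : ∀ k i, constantCoeff (t k i) = 0 := by
    intro k
    induction k with
    | zero => intro i; simp [t]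
    | succ k ih => rw [ht]; exact hc _ ih
  have hstep : ∀ k r, AgreeTo k (t (k + r)) (t k) := by
    intro k
    induction k with
    | zero => intro r; exact AgreeTo.zero _ _
    | succ k ih =>
      intro r
      rw [Nat.add_right_comm, ht, ht]
      exact hΦ _ _ _ (hct _) (hct _) (ih r)
  let L : Fin n → PowerSeries ℚ := fun i => mk fun m => coeff m (t (n * (m + 1)) i)
  have hL : ∀ k, AgreeTo k L (t k) := by
    intro k i
    have hn : 0 < n := i.pos
    rw [X_pow_dvd_iff]
    intro m hm
    rw [map_sub, sub_eq_zero, coeff_mk]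
    rcases le_total k (n * (m + 1)) with h | h
    · obtain ⟨r, hr⟩ := Nat.exists_eq_add_of_le h
      rw [hr]
      exact (hstep k r).coeff_eq i hm
    · obtain ⟨r, hr⟩ := Nat.exists_eq_add_of_le h
      rw [hr]
      refine ((hstep (n * (m + 1)) r).coeff_eq i ?_).symm
      rw [Nat.mul_add_div hn]
      exact Nat.lt_add_right _ (Nat.lt_succ_self m)
  have hcL : ∀ i, constantCoeff (L i) = 0 := by
    intro i
    rw [← coeff_zero_eq_constantCoeff_apply, coeff_mk, coeff_zero_eq_constantCoeff_apply]
    exact hct _ i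
  refine ⟨L, ⟨hcL, ?_⟩, ?_⟩
  · refine fun i => congrFun (AgreeTo.eq_of_forall (T := Φ L) fun l => ?_) i
    refine AgreeTo.mono (Nat.le_succ l) ((hL (l + 1)).trans ?_)
    rw [ht]
    exact (hΦ _ _ _ hcL (hct l) (hL l)).symm
  · rintro S ⟨hcS, hS⟩
    refine AgreeTo.eq_of_forall fun l => AgreeTo.trans (T := t l) ?_ (hL l).symm
    induction l with
    | zero => exact AgreeTo.zero _ _
    | succ l ih =>
      rw [ht, show S = Φ S from funext hS]
      exact hΦ _ _ _ hcS (hct l) ih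

theorem X_dvd_list_map_prod {a : ℕ → PowerSeries ℚ} (ha : ∀ k, X ∣ a k) {s : List ℕ}
    (hs : s ≠ []) : X ∣ (s.map a).prod := by
  obtain ⟨k, s, rfl⟩ := List.exists_cons_of_ne_nil hs
  simpa using (ha k).mul_right _

theorem X_pow_dvd_list_map_prod_sub {a b : ℕ → PowerSeries ℚ} {p : ℕ}
    (hab : ∀ k, X ^ p ∣ a k - b k) (s : List ℕ) :
    X ^ p ∣ (s.map a).prod - (s.map b).prod := by
  induction s with
  | nil => simp
  | cons k s ih =>
    have h : ((k :: s).map a).prod - ((k :: s).map b).prod =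
        (a k - b k) * (s.map a).prod + b k * ((s.map a).prod - (s.map b).prod) := by
      simp; ring
    rw [h]
    exact dvd_add ((hab k).mul_right _) (ih.mul_left _)

theorem X_pow_succ_dvd_list_map_prod_sub {a b : ℕ → PowerSeries ℚ} {p : ℕ}
    (ha : ∀ k, X ∣ a k) (hb : ∀ k, X ∣ b k) (hab : ∀ k, X ^ p ∣ a k - b k) (k : ℕ)
    {s : List ℕ} (hs : s ≠ []) :
    X ^ (p + 1) ∣ ((k :: s).map a).prod - ((k :: s).map b).prod := by
  have h : ((k :: s).map a).prod - ((k :: s).map b).prod =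
      (a k - b k) * (s.map a).prod + ((s.map a).prod - (s.map b).prod) * b k := by
    simp; ring
  rw [h, pow_succ]
  exact dvd_add (mul_dvd_mul (hab k) (X_dvd_list_map_prod ha hs))
    (mul_dvd_mul (X_pow_dvd_list_map_prod_sub hab s) (hb k))

theorem X_dvd_hcomp {j : ℕ} (hj : 0 < j) {a : ℕ → PowerSeries ℚ} (ha : ∀ k, X ∣ a k) :
    X ∣ hcomp j a := by
  refine Finset.dvd_sum fun c _ => X_dvd_list_map_prod ha fun h => ?_
  have := c.blocks_sum
  simp [h] at this
  omega

/-- Only the linear term of `hcomp j` fails to gain an order of agreement. -/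
theorem X_pow_dvd_hcomp_sub {j p M : ℕ} (hj : 0 < j) {a b : ℕ → PowerSeries ℚ}
    (ha : ∀ k, X ∣ a k) (hb : ∀ k, X ∣ b k) (hab : ∀ k, X ^ p ∣ a k - b k)
    (hM : M ≤ p + 1) (hlin : X ^ M ∣ a j - b j) : X ^ M ∣ hcomp j a - hcomp j b := by
  rw [hcomp, hcomp, ← Finset.sum_sub_distrib]
  refine Finset.dvd_sum fun c _ => ?_
  have hsum := c.blocks_sum
  generalize c.blocks = s at hsum
  match s with
  | [] => simp at hsum; omega
  | [k] =>
    obtain rfl : k = j := by simpa using hsum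
    simpa using hlin
  | k :: k' :: s =>
    exact (pow_dvd_pow _ hM).trans
      (X_pow_succ_dvd_list_map_prod_sub ha hb hab k (List.cons_ne_nil k' s))

theorem inv_one_sub_sub_inv_one_sub {f g : PowerSeries ℚ} (hf : constantCoeff f = 0)
    (hg : constantCoeff g = 0) :
    (1 - f)⁻¹ - (1 - g)⁻¹ = (f - g) * ((1 - f)⁻¹ * (1 - g)⁻¹) := by
  have h₁ : (1 - f) * (1 - f)⁻¹ = 1 := PowerSeries.mul_inv_cancel _ (by simp [hf])
  have h₂ : (1 - g) * (1 - g)⁻¹ = 1 := PowerSeries.mul_inv_cancel _ (by simp [hg])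
  linear_combination (1 - g)⁻¹ * h₁ - (1 - f)⁻¹ * h₂

/-- The arguments `τ_k` substituted into the composition polynomials, with the coordinate `z`
in the role of `T_0`. -/
noncomputable def treeArg {n : ℕ} (z : Fin n) (T : Fin n → PowerSeries ℚ) (k : ℕ) :
    PowerSeries ℚ :=
  if hk : 1 ≤ k ∧ k < n then T ⟨k, hk.2⟩ * (1 - T z)⁻¹
  else if k = n then X * (1 - T z)⁻¹
  else 0

section treeArg

variable {n : ℕ} {z : Fin n} {S T : Fin n → PowerSeries ℚ}

theorem X_dvd_treeArg (hT : ∀ i, constantCoeff (T i) = 0) (k : ℕ) : X ∣ treeArg z T k := by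
  unfold treeArg
  split_ifs
  · exact (X_dvd_iff.2 (hT _)).mul_right _
  · exact dvd_mul_right _ _
  · exact dvd_zero _

theorem AgreeTo.X_pow_dvd_inv_sub {l : ℕ} (hS : ∀ i, constantCoeff (S i) = 0)
    (hT : ∀ i, constantCoeff (T i) = 0) (h : AgreeTo l S T) (z : Fin n) :
    X ^ (l / n) ∣ (1 - S z)⁻¹ - (1 - T z)⁻¹ := by
  rw [inv_one_sub_sub_inv_one_sub (hS _) (hT _)]
  exact ((pow_dvd_pow _ (Nat.div_le_div_right (Nat.le_add_right _ _))).trans (h z)).mul_right _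

theorem AgreeTo.X_pow_dvd_treeArg_sub {l M : ℕ} (hS : ∀ i, constantCoeff (S i) = 0)
    (hT : ∀ i, constantCoeff (T i) = 0) (h : AgreeTo l S T) (k : ℕ)
    (hM : M ≤ l / n + 1) (hMk : k < n → M ≤ (l + k) / n) :
    X ^ M ∣ treeArg z S k - treeArg z T k := by
  have hu : ∀ f : PowerSeries ℚ, X ∣ f → X ^ M ∣ f * ((1 - S z)⁻¹ - (1 - T z)⁻¹) :=
    fun f hf => by
      refine (pow_dvd_pow _ hM).trans ?_
      rw [pow_succ']
      exact mul_dvd_mul hf (h.X_pow_dvd_inv_sub hS hT z)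
  unfold treeArg
  split_ifs with hk hk'
  · have e : ∀ f g u v : PowerSeries ℚ, f * u - g * v = (f - g) * u + g * (u - v) := by
      intros; ring
    rw [e]
    exact dvd_add (((pow_dvd_pow _ (hMk hk.2)).trans (h ⟨k, hk.2⟩)).mul_right _)
      (hu _ (X_dvd_iff.2 (hT _)))
  · rw [← mul_sub]
    exact hu _ dvd_rfl
  · simp

theorem existsUnique_treeArg_fixed (z : Fin n) :
    ∃! T : Fin n → PowerSeries ℚ, (∀ i, constantCoeff (T i) = 0) ∧
      ∀ i : Fin n, T i = (1 - T z)⁻¹ * hcomp ((i : ℕ) + 2) (treeArg z T) := by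
  refine existsUnique_fixed_of_agreeTo
    (fun T i => (1 - T z)⁻¹ * hcomp ((i : ℕ) + 2) (treeArg z T)) ?_ ?_
  · intro T hT i
    exact X_dvd_iff.1 ((X_dvd_hcomp (by omega) (X_dvd_treeArg hT)).mul_left _)
  · intro l S T hS hT h i
    have hM : (l + 1 + i) / n ≤ l / n + 1 := by
      rw [← Nat.add_div_right l z.pos]
      exact Nat.div_le_div_right (by omega)
    have e : ∀ f g u v : PowerSeries ℚ, u * f - v * g = (u - v) * f + v * (f - g) := by
      intros; ring
    dsimp only
    rw [e]
    refine dvd_add ((pow_dvd_pow _ hM).trans ?_) (Dvd.dvd.mul_left ?_ _)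
    · rw [pow_succ]
      exact mul_dvd_mul (h.X_pow_dvd_inv_sub hS hT z)
        (X_dvd_hcomp (by omega) (X_dvd_treeArg hS))
    · refine X_pow_dvd_hcomp_sub (p := l / n) (by omega) (X_dvd_treeArg hS)
        (X_dvd_treeArg hT) (fun k => ?_) hM ?_
      · exact h.X_pow_dvd_treeArg_sub hS hT k (Nat.le_succ _)
          fun _ => Nat.div_le_div_right (by omega)
      · exact h.X_pow_dvd_treeArg_sub hS hT _ hM fun _ => Nat.div_le_div_right (by omega)

end treeArg

theorem exists_unique_tree_series (d : ℕ) (hd : 3 ≤ d) :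
    ∃! T : Fin (d - 2) → PowerSeries ℚ,
      (∀ i, PowerSeries.constantCoeff (T i) = 0) ∧
      ∀ i : Fin (d - 2),
        T i = (1 - T ⟨0, by omega⟩)⁻¹ *
          hcomp ((i : ℕ) + 2) (fun k =>
            if hk : 1 ≤ k ∧ k ≤ d - 3 then
              T ⟨k, by omega⟩ * (1 - T ⟨0, by omega⟩)⁻¹
            else if k = d - 2 then
              PowerSeries.X * (1 - T ⟨0, by omega⟩)⁻¹
            else 0) := by
  convert existsUnique_treeArg_fixed (⟨0, by omega⟩ : Fin (d - 2)) using 9 with T i k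
  unfold treeArg
  split_ifs <;> first | rfl | omega
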